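/- arXiv:2002.07633 — 2 statements merged into one kernel-verified Lean document; each statement's English description precedes it below -/
import Mathlib

section
/- Let τ > 0 and 0 < β₋ ≤ β₊. Suppose {x^k} and {b^k} are sequences in ℝ^N with {b^k} bounded, β_k ∈ [β₋, β₊] for all k, and for every k the point x^{k+1} is a global minimizer over ℝ^N of the function x ↦ τ f(x) + ⟨x − x^k, b^k⟩_W + ((β_k + 1)/2)‖x − x^k‖_W². If a subsequence satisfies x^{k_t} → x* and x^{k_t+1} − x^{k_t} → 0 as t → ∞, then lim_{t→∞} f(x^{k_t+1}) = f(x*). -/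
open Matrix Filter

noncomputable section

/-- W-weighted inner product -/
def innW {N : ℕ} (W : Matrix (Fin N) (Fin N) ℝ) (x y : Fin N → ℝ) : ℝ :=
  x ⬝ᵥ W.mulVec y

/-- W-weighted norm -/
def normW {N : ℕ} (W : Matrix (Fin N) (Fin N) ℝ) (x : Fin N → ℝ) : ℝ :=
  Real.sqrt (innW W x x)

theorem tendsto_innW_of_tendsto_zero_of_bounded {N : ℕ} (W : Matrix (Fin N) (Fin N) ℝ)
    {d b : ℕ → Fin N → ℝ} {M : ℝ} (hb : ∀ t i, |b t i| ≤ M)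
    (hd : Tendsto d atTop (nhds 0)) :
    Tendsto (fun t => innW W (d t) (b t)) atTop (nhds 0) := by
  have hcoord : ∀ i, Tendsto (fun t => d t i * (W.mulVec (b t)) i) atTop (nhds 0) := by
    intro i
    have hdi : Tendsto (fun t => d t i) atTop (nhds 0) := (tendsto_pi_nhds.1 hd) i
    refine hdi.zero_mul_isBoundedUnder_le
      (isBoundedUnder_of ⟨∑ j, |W i j| * M, fun t => ?_⟩)
    change |∑ j, W i j * b t j| ≤ ∑ j, |W i j| * M
    refine (Finset.abs_sum_le_sum_abs _ _).trans (Finset.sum_le_sum fun j _ => ?_)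
    rw [abs_mul]
    exact mul_le_mul_of_nonneg_left (hb t j) (abs_nonneg _)
  simpa [innW, dotProduct] using tendsto_finsetSum Finset.univ fun i _ => hcoord i

theorem tendsto_normW_of_tendsto_zero {N : ℕ} (W : Matrix (Fin N) (Fin N) ℝ)
    {d : ℕ → Fin N → ℝ} (hd : Tendsto d atTop (nhds 0)) :
    Tendsto (fun t => normW W (d t)) atTop (nhds 0) := by
  have hcont : Continuous (normW W) := by
    unfold normW innW
    fun_prop
  have h := (hcont.tendsto 0).comp hd
  have h0 : normW W 0 = 0 := by simp [normW, innW]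
  rwa [h0] at h

theorem tendsto_prox_perturbation {N : ℕ} (W : Matrix (Fin N) (Fin N) ℝ)
    {d b : ℕ → Fin N → ℝ} {β : ℕ → ℝ} {M C : ℝ} (hb : ∀ t i, |b t i| ≤ M)
    (hβ : ∀ t, |(β t + 1) / 2| ≤ C) (hd : Tendsto d atTop (nhds 0)) :
    Tendsto (fun t => innW W (d t) (b t) + (β t + 1) / 2 * normW W (d t) ^ 2)
      atTop (nhds 0) := by
  have hsq : Tendsto (fun t => normW W (d t) ^ 2) atTop (nhds 0) := by
    simpa using (tendsto_normW_of_tendsto_zero W hd).pow 2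
  have hquad : Tendsto (fun t => (β t + 1) / 2 * normW W (d t) ^ 2) atTop (nhds 0) :=
    isBoundedUnder_le_mul_tendsto_zero (isBoundedUnder_of ⟨C, hβ⟩) hsq
  simpa using (tendsto_innW_of_tendsto_zero_of_bounded W hb hd).add hquad

/-- Cancelling finite perturbations in an inequality between scaled extended reals. -/
theorem le_coe_add_div_of_mul_add_le {τ v r s : ℝ} (hτ : 0 < τ) {u : EReal}
    (h : (τ : EReal) * u + (r : EReal) ≤ (τ : EReal) * (v : EReal) + (s : EReal)) :
    u ≤ ((v + (s - r) / τ : ℝ) : EReal) := by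
  induction u with
  | bot => exact bot_le
  | top =>
    rw [EReal.coe_mul_top_of_pos hτ, EReal.top_add_coe] at h
    norm_cast at h
  | coe u =>
    norm_cast at h ⊢
    rw [← sub_le_iff_le_add', le_div_iff₀ hτ]
    linarith

/-- continuity of f-values along the proximal iterates: if x^{k+1} globally
minimizes x ↦ τf(x) + ⟨x − x^k, b^k⟩_W + ((β_k+1)/2)‖x − x^k‖_W² with {b^k} bounded
and β_k ∈ [β₋, β₊], and if x^{k_t} → x* with x^{k_t+1} − x^{k_t} → 0, then
f(x^{k_t+1}) → f(x*). -/
theorem stmt6 {N : ℕ}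
    (W : Matrix (Fin N) (Fin N) ℝ) (hWpd : W.PosDef)
    (f : (Fin N → ℝ) → EReal)
    (hf_proper : (∃ x, f x ≠ ⊤) ∧ (∀ x, f x ≠ ⊥))
    (hf_lsc : LowerSemicontinuous f)
    (τ : ℝ) (hτ : 0 < τ)
    (βm βp : ℝ) (hβm : 0 < βm) (hβmp : βm ≤ βp)
    (x b : ℕ → Fin N → ℝ) (β : ℕ → ℝ)
    (hb : ∃ M : ℝ, ∀ k, Real.sqrt (∑ i, b k i ^ 2) ≤ M)
    (hβ : ∀ k, βm ≤ β k ∧ β k ≤ βp)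
    (hmin : ∀ (k : ℕ) (x' : Fin N → ℝ),
      (τ : EReal) * f (x (k + 1))
          + ((innW W (x (k + 1) - x k) (b k)
              + (β k + 1) / 2 * normW W (x (k + 1) - x k) ^ 2 : ℝ) : EReal)
        ≤ (τ : EReal) * f x'
          + ((innW W (x' - x k) (b k)
              + (β k + 1) / 2 * normW W (x' - x k) ^ 2 : ℝ) : EReal))
    (kt : ℕ → ℕ) (hkt : StrictMono kt) (xstar : Fin N → ℝ)
    (hconv : Tendsto (fun t => x (kt t)) atTop (nhds xstar))
    (hdiff : Tendsto (fun t => x (kt t + 1) - x (kt t)) atTop (nhds 0)) :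
    Tendsto (fun t => f (x (kt t + 1))) atTop (nhds (f xstar)) := by
  obtain ⟨M, hM⟩ := hb
  have hbM : ∀ k i, |b k i| ≤ M := fun k i =>
    (Real.abs_le_sqrt (Finset.single_le_sum (f := fun i => b k i ^ 2)
      (fun j _ => sq_nonneg _) (Finset.mem_univ i))).trans (hM k)
  have hβC : ∀ k, |(β k + 1) / 2| ≤ (βp + 1) / 2 := fun k => by
    obtain ⟨h₁, h₂⟩ := hβ k
    rw [abs_of_nonneg (by linarith)]
    linarith
  have hr := tendsto_prox_perturbation W (fun t => hbM (kt t)) (fun t => hβC (kt t)) hdiff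
  have hs := tendsto_prox_perturbation W (d := fun t => xstar - x (kt t))
    (fun t => hbM (kt t)) (fun t => hβC (kt t))
    (by simpa using (tendsto_const_nhds (x := xstar)).sub hconv)
  have hnext : Tendsto (fun t => x (kt t + 1)) atTop (nhds xstar) := by
    simpa using hdiff.add hconv
  refine tendsto_order.2 ⟨fun a ha => hnext.eventually (hf_lsc xstar a ha), fun a ha => ?_⟩
  have hmin' := fun t => hmin (kt t) xstar
  lift f xstar to ℝ using ⟨ha.ne_top, hf_proper.2 xstar⟩ with v
  have hlim := (hs.sub hr).div_const τ |>.const_add v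
  rw [sub_zero, zero_div, add_zero] at hlim
  filter_upwards [(EReal.tendsto_coe.2 hlim).eventually_lt_const ha] with t ht
  exact (le_coe_add_div_of_mul_add_le hτ (hmin' t)).trans_lt ht
end
end

section
/- If ργ⁴ ≤ 4096/27, then the pixelwise Exp fidelity φ is strictly convex on ℝ. -/
noncomputable section

/-- The pixelwise Exp fidelity `φ(x) = x + v e^{−x} + ρ(√(eˣ/v) − γ)²`. -/
def expFid (v ρ γ : ℝ) (x : ℝ) : ℝ :=
  x + v * Real.exp (-x) + ρ * (Real.sqrt (Real.exp x / v) - γ) ^ 2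

theorem quartic_nonneg {ρ γ m : ℝ} (hρ : 0 < ρ) (hγ : 0 ≤ γ) (hm : 0 < m)
    (h : ρ * γ ^ 4 ≤ 4096 / 27) : 0 ≤ 2 + ρ * (2 * m - γ) * m ^ 3 := by
  have hfac : 0 ≤ ρ * ((m - 3 * γ / 8) ^ 2 * (m ^ 2 + γ * m / 4 + 3 * γ ^ 2 / 64)) := by
    positivity
  linarith

theorem strictMonoOn_inv_sq_add {ρ γ : ℝ} (hρ : 0 < ρ) (hγ : 0 ≤ γ)
    (h : ρ * γ ^ 4 ≤ 4096 / 27) :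
    StrictMonoOn (fun t : ℝ => 1 - (t ^ 2)⁻¹ + ρ * (t ^ 2 - γ * t)) (Set.Ioi 0) := by
  intro s hs t ht hst
  rw [Set.mem_Ioi] at hs ht
  have hm : 0 < (s + t) / 2 := by positivity
  have hprod : (s * t) ^ 2 < ((s + t) / 2) ^ 4 := by
    have hamgm : s * t < ((s + t) / 2) ^ 2 := by nlinarith [sq_pos_of_pos (sub_pos.2 hst)]
    calc (s * t) ^ 2 < (((s + t) / 2) ^ 2) ^ 2 := by gcongr
      _ = _ := by ring
  have hq := mul_nonneg hm.le (quartic_nonneg hρ hγ hm h)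
  have key : 0 < (s + t) + ρ * (s + t - γ) * (s * t) ^ 2 := by
    rcases le_or_gt γ (s + t) with hle | hlt
    · have : 0 ≤ s + t - γ := sub_nonneg.2 hle
      positivity
    · have := mul_lt_mul_of_pos_left hprod (mul_pos hρ (sub_pos.2 hlt))
      linarith
  have hdiff : (1 - (t ^ 2)⁻¹ + ρ * (t ^ 2 - γ * t)) - (1 - (s ^ 2)⁻¹ + ρ * (s ^ 2 - γ * s))
      = (t - s) * ((s + t) + ρ * (s + t - γ) * (s * t) ^ 2) / (s * t) ^ 2 := by
    field_simp
    ring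
  have hpos := div_pos (mul_pos (sub_pos.2 hst) key) (pow_pos (mul_pos hs ht) 2)
  exact sub_pos.1 (hdiff ▸ hpos)

theorem hasDerivAt_expFid {v : ℝ} (hv : 0 < v) (ρ γ x : ℝ) :
    HasDerivAt (expFid v ρ γ)
      (1 - (Real.sqrt (Real.exp x / v) ^ 2)⁻¹
        + ρ * (Real.sqrt (Real.exp x / v) ^ 2 - γ * Real.sqrt (Real.exp x / v))) x := by
  have hpos : 0 < Real.exp x / v := by positivity
  have hsqrt := ((Real.hasDerivAt_exp x).div_const v).sqrt hpos.ne'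
  have hfid := ((hasDerivAt_id x).add (((hasDerivAt_id x).neg.exp).const_mul v)).add
    (((hsqrt.sub_const γ).pow 2).const_mul ρ)
  refine hfid.congr_deriv ?_
  have ht : 0 < Real.sqrt (Real.exp x / v) := Real.sqrt_pos.2 hpos
  have hsq : Real.sqrt (Real.exp x / v) ^ 2 = Real.exp x / v := Real.sq_sqrt hpos.le
  have hinv : (Real.sqrt (Real.exp x / v) ^ 2)⁻¹ = v * Real.exp (-x) := by
    rw [hsq, inv_div, Real.exp_neg, div_eq_mul_inv]
  rw [hinv, ← hsq]
  simp only [Real.sqrt_sq ht.le, Pi.neg_apply, id_eq]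
  field_simp
  ring

/-- if `ργ⁴ ≤ 4096/27`, the pixelwise Exp fidelity is strictly convex on ℝ. -/
theorem stmt16 (v ρ γ : ℝ) (hv : 0 < v) (hρ : 0 < ρ) (hγ : 1 ≤ γ)
    (h : ρ * γ ^ 4 ≤ 4096 / 27) :
    StrictConvexOn ℝ Set.univ (expFid v ρ γ) := by
  have hderiv := hasDerivAt_expFid hv ρ γ
  refine StrictMono.strictConvexOn_univ_of_deriv
    (continuous_iff_continuousAt.2 fun x => (hderiv x).continuousAt) fun x y hxy => ?_
  rw [(hderiv x).deriv, (hderiv y).deriv]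
  exact strictMonoOn_inv_sq_add hρ (zero_le_one.trans hγ) h
    (Real.sqrt_pos.2 (by positivity)) (Real.sqrt_pos.2 (by positivity))
    (Real.sqrt_lt_sqrt (by positivity) (by gcongr))
end
end
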